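/- (Theorem 1) Let X = (X₁,…,X_p) be as in the Lévy–Khintchine setup, and let β_r ∈ [0,∞) for r = 1,…,p. Then E(∏_{r=1}^{p} |X_r|^{α_r}) < ∞ for all α_r ∈ [0, β_r], r = 1,…,p, if and only if ∫_{ℝ^p} (∏_{r=1}^{p} |x_r|^{α_r}) dν₁(x) < ∞ for all α_r ∈ [0, β_r], r = 1,…,p. -/

import Mathlib

open MeasureTheory ProbabilityTheory
open scoped RealInnerProductSpace

section CompoundPoisson

open scoped ENNReal Nat

variable {E : Type*} [NormedAddCommGroup E] [MeasurableSpace E]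
  [BorelSpace E] [SecondCountableTopology E]

/-- The `n`-fold convolution power of a measure. -/
noncomputable def convPow (ρ : Measure E) : ℕ → Measure E
  | 0 => Measure.dirac 0
  | n + 1 => ρ ∗ convPow ρ n

instance isFiniteMeasure_convPow (ρ : Measure E) [IsFiniteMeasure ρ] (n : ℕ) :
    IsFiniteMeasure (convPow ρ n) := by
  induction n with
  | zero => unfold convPow; infer_instance
  | succ n ih => unfold convPow; infer_instance

lemma convPow_one (ρ : Measure E) [IsFiniteMeasure ρ] : convPow ρ 1 = ρ := by
  simp [convPow]

/-- A submultiplicative function integrates submultiplicatively against a convolution. -/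
lemma lintegral_conv_le_mul {h : E → ℝ} (hm : Measurable h) (h0 : ∀ x, 0 ≤ h x)
    (hsub : ∀ x y, h (x + y) ≤ h x * h y) (μ ρ : Measure E) [SFinite ρ] :
    ∫⁻ x, .ofReal (h x) ∂(μ ∗ ρ) ≤ (∫⁻ x, .ofReal (h x) ∂μ) * ∫⁻ x, .ofReal (h x) ∂ρ := by
  rw [Measure.lintegral_conv (by fun_prop), ← lintegral_mul_const _ (by fun_prop)]
  refine lintegral_mono fun x ↦ ?_
  rw [← lintegral_const_mul _ (by fun_prop)]
  refine lintegral_mono fun y ↦ ?_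
  rw [← ENNReal.ofReal_mul (h0 x)]
  exact ENNReal.ofReal_le_ofReal (hsub x y)

lemma lintegral_convPow_le_pow {h : E → ℝ} (hm : Measurable h) (h0 : ∀ x, 0 ≤ h x)
    (hsub : ∀ x y, h (x + y) ≤ h x * h y) (hz : h 0 ≤ 1) (ρ : Measure E) [IsFiniteMeasure ρ]
    (n : ℕ) :
    ∫⁻ x, .ofReal (h x) ∂(convPow ρ n) ≤ (∫⁻ x, .ofReal (h x) ∂ρ) ^ n := by
  induction n with
  | zero =>
    rw [convPow, lintegral_dirac' _ (by fun_prop), pow_zero]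
    exact ENNReal.ofReal_le_one.2 hz
  | succ n ih =>
    rw [convPow, pow_succ']
    exact (lintegral_conv_le_mul hm h0 hsub _ _).trans (by gcongr)

/-- The compound Poisson distribution with finite Lévy measure `ρ`. -/
noncomputable def compoundPoisson (ρ : Measure E) : Measure E :=
  Measure.sum fun n ↦ ENNReal.ofReal (Real.exp (-ρ.real Set.univ) / n !) • convPow ρ n

lemma hasSum_exp_neg_div_factorial_mul_pow (c l : ℝ) :
    HasSum (fun n : ℕ ↦ Real.exp (-c) / n ! * l ^ n) (Real.exp (l - c)) := by
  have := (NormedSpace.expSeries_div_hasSum_exp l).mul_left (Real.exp (-c))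
  rw [← Real.exp_eq_exp_ℝ, ← Real.exp_add] at this
  convert! this using 1
  · ext n; ring
  · ring_nf

lemma lintegral_compoundPoisson_le {h : E → ℝ} (hm : Measurable h) (h0 : ∀ x, 0 ≤ h x)
    (hsub : ∀ x y, h (x + y) ≤ h x * h y) (hz : h 0 ≤ 1) (ρ : Measure E) [IsFiniteMeasure ρ]
    (hint : Integrable h ρ) :
    ∫⁻ x, .ofReal (h x) ∂(compoundPoisson ρ) ≤
      ENNReal.ofReal (Real.exp (∫ x, h x ∂ρ - ρ.real Set.univ)) := by
  have hl : 0 ≤ ∫ x, h x ∂ρ := integral_nonneg h0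
  have hs := hasSum_exp_neg_div_factorial_mul_pow (ρ.real Set.univ) (∫ x, h x ∂ρ)
  rw [← hs.tsum_eq, ENNReal.ofReal_tsum_of_nonneg (fun n ↦ by positivity) hs.summable,
    compoundPoisson, lintegral_sum_measure]
  refine ENNReal.tsum_le_tsum fun n ↦ ?_
  rw [lintegral_smul_measure, smul_eq_mul, ENNReal.ofReal_mul (by positivity),
    ENNReal.ofReal_pow hl, ofReal_integral_eq_lintegral_ofReal hint (.of_forall h0)]
  gcongr
  exact lintegral_convPow_le_pow hm h0 hsub hz ρ n

lemma isFiniteMeasure_compoundPoisson (ρ : Measure E) [IsFiniteMeasure ρ] :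
    IsFiniteMeasure (compoundPoisson ρ) := by
  have := lintegral_compoundPoisson_le (h := fun _ : E ↦ 1) measurable_const (by simp) (by simp)
    le_rfl ρ (integrable_const _)
  refine ⟨?_⟩
  simp only [ENNReal.ofReal_one, lintegral_one] at this
  exact this.trans_lt ENNReal.ofReal_lt_top

lemma mul_lintegral_le_lintegral_compoundPoisson (f : E → ℝ≥0∞) (ρ : Measure E)
    [IsFiniteMeasure ρ] :
    ENNReal.ofReal (Real.exp (-ρ.real Set.univ)) * ∫⁻ x, f x ∂ρ ≤
      ∫⁻ x, f x ∂(compoundPoisson ρ) := by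
  have h := ENNReal.le_tsum (f := fun n ↦ ∫⁻ x, f x
    ∂(ENNReal.ofReal (Real.exp (-ρ.real Set.univ) / n !) • convPow ρ n)) 1
  rw [← lintegral_sum_measure, convPow_one, lintegral_smul_measure] at h
  simpa [compoundPoisson] using h

variable [InnerProductSpace ℝ E]

lemma charFun_convPow (ρ : Measure E) [IsFiniteMeasure ρ] (n : ℕ) (t : E) :
    charFun (convPow ρ n) t = charFun ρ t ^ n := by
  induction n with
  | zero => simp [convPow]
  | succ n ih => rw [convPow, charFun_conv, ih, pow_succ']

lemma charFun_sub_measureReal_univ (ρ : Measure E) [IsFiniteMeasure ρ] (t : E) :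
    charFun ρ t - ρ.real Set.univ = ∫ x, (Complex.exp (⟪x, t⟫ * Complex.I) - 1) ∂ρ := by
  rw [integral_sub _ (integrable_const _), charFun_apply]
  · simp
  · exact (integrable_const (1 : ℝ)).mono' (by fun_prop)
      (.of_forall fun x ↦ (Complex.norm_exp_ofReal_mul_I _).le)

lemma charFun_compoundPoisson (ρ : Measure E) [IsFiniteMeasure ρ] (t : E) :
    charFun (compoundPoisson ρ) t = Complex.exp (charFun ρ t - ρ.real Set.univ) := by
  have := isFiniteMeasure_compoundPoisson ρ
  have hint : Integrable (fun x : E ↦ Complex.exp (⟪x, t⟫ * Complex.I)) (compoundPoisson ρ) :=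
    (integrable_const (1 : ℝ)).mono' (by fun_prop)
      (.of_forall fun x ↦ (Complex.norm_exp_ofReal_mul_I _).le)
  have h1 := hasSum_integral_measure hint
  have h2 := (NormedSpace.expSeries_div_hasSum_exp (charFun ρ t)).mul_left
    (Complex.exp (-ρ.real Set.univ))
  rw [← Complex.exp_eq_exp_ℂ, ← Complex.exp_add] at h2
  rw [sub_eq_neg_add, ← h2.tsum_eq]
  refine h1.tsum_eq.symm.trans (tsum_congr fun n ↦ ?_)
  rw [integral_smul_measure, ← charFun_apply, charFun_convPow,
    ENNReal.toReal_ofReal (by positivity), Complex.real_smul]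
  push_cast
  ring

instance isProbabilityMeasure_compoundPoisson (ρ : Measure E) [IsFiniteMeasure ρ] :
    IsProbabilityMeasure (compoundPoisson ρ) := by
  have := isFiniteMeasure_compoundPoisson ρ
  have h := charFun_compoundPoisson ρ 0
  simp only [charFun_zero, sub_self, Complex.exp_zero] at h
  exact isProbabilityMeasure_iff_real.2 (by exact_mod_cast h)

end CompoundPoisson

section WeakLimit

open Filter Topology
open scoped ENNReal NNReal

variable {E : Type*} [NormedAddCommGroup E] [InnerProductSpace ℝ E] [MeasurableSpace E]
  [BorelSpace E] [SecondCountableTopology E]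

/-- If `f y ≤ h x * f (x + y)`, then `μ ∗ compoundPoisson ρ` controls the `ρ`-integral of `f`
in terms of the `μ`-integral of `h`. -/
lemma lintegral_le_mul_lintegral_conv_compoundPoisson {h : E → ℝ} (hm : Measurable h)
    (h0 : ∀ x, 0 ≤ h x) {f : E → ℝ} (hfm : Measurable f)
    (hfh : ∀ x y, f y ≤ h x * f (x + y)) (μ ρ : Measure E) [IsProbabilityMeasure μ]
    [IsFiniteMeasure ρ] (hfρ : ∫⁻ y, .ofReal (f y) ∂ρ ≠ ⊤) {M : ℝ} (hM : 0 < M)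
    (hμ : ∫⁻ x, .ofReal (h x) ∂μ ≤ ENNReal.ofReal M) :
    ∫⁻ y, .ofReal (f y) ∂ρ ≤ ENNReal.ofReal (4 * M * Real.exp (ρ.real Set.univ)) *
      ∫⁻ z, .ofReal (f z) ∂(μ ∗ compoundPoisson ρ) := by
  set g := ∫⁻ y, .ofReal (f y) ∂ρ
  have hshift (x : E) : g ≤ .ofReal (h x) * ∫⁻ y, .ofReal (f (x + y)) ∂ρ := by
    rw [← lintegral_const_mul _ (by fun_prop)]
    refine lintegral_mono fun y ↦ ?_
    rw [← ENNReal.ofReal_mul (h0 x)]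
    exact ENNReal.ofReal_le_ofReal (hfh x y)
  have hsplit (x : E) : g ≤ .ofReal (2 * M) * ∫⁻ y, .ofReal (f (x + y)) ∂ρ +
      g * ENNReal.ofReal (1 / (2 * M)) * .ofReal (h x) := by
    rcases le_total (h x) (2 * M) with hx | hx
    · exact le_add_right ((hshift x).trans (by gcongr))
    · refine le_add_left ?_
      rw [mul_assoc, ← ENNReal.ofReal_mul (by positivity)]
      refine le_mul_of_one_le_right zero_le (ENNReal.one_le_ofReal.2 ?_)
      rw [one_div, inv_mul_eq_div, le_div_iff₀ (by positivity)]
      linarith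
  have hint := lintegral_mono (μ := μ) hsplit
  rw [lintegral_const, measure_univ, mul_one, lintegral_add_right _ (by fun_prop),
    lintegral_const_mul _ (by fun_prop), lintegral_const_mul _ (by fun_prop)] at hint
  have hhalf : g * ENNReal.ofReal (1 / (2 * M)) * ∫⁻ x, .ofReal (h x) ∂μ ≤ g / 2 := by
    calc _ ≤ g * ENNReal.ofReal (1 / (2 * M)) * ENNReal.ofReal M := by gcongr
      _ = g / 2 := by
        rw [mul_assoc, ← ENNReal.ofReal_mul (by positivity),
          show 1 / (2 * M) * M = 2⁻¹ by field_simp, ENNReal.ofReal_inv_of_pos two_pos,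
          ENNReal.ofReal_ofNat, div_eq_mul_inv]
  have hkey : g / 2 ≤ .ofReal (2 * M) * ∫⁻ x, ∫⁻ y, .ofReal (f (x + y)) ∂ρ ∂μ := by
    have := hint.trans (add_le_add_right hhalf _)
    nth_rw 1 [← ENNReal.add_halves g] at this
    exact (ENNReal.add_le_add_iff_right (ENNReal.div_ne_top hfρ two_ne_zero)).1 this
  have hconv : ENNReal.ofReal (Real.exp (-ρ.real Set.univ)) *
      ∫⁻ x, ∫⁻ y, .ofReal (f (x + y)) ∂ρ ∂μ ≤ ∫⁻ z, .ofReal (f z) ∂(μ ∗ compoundPoisson ρ) := by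
    rw [Measure.lintegral_conv (by fun_prop), ← lintegral_const_mul _ (by fun_prop)]
    exact lintegral_mono fun x ↦ mul_lintegral_le_lintegral_compoundPoisson _ ρ
  calc g = 2 * (g / 2) := (ENNReal.mul_div_cancel two_ne_zero ENNReal.ofNat_ne_top).symm
    _ ≤ 2 * (.ofReal (2 * M) * ∫⁻ x, ∫⁻ y, .ofReal (f (x + y)) ∂ρ ∂μ) := by gcongr
    _ = ENNReal.ofReal (4 * M * Real.exp (ρ.real Set.univ)) *
        (ENNReal.ofReal (Real.exp (-ρ.real Set.univ)) *
          ∫⁻ x, ∫⁻ y, .ofReal (f (x + y)) ∂ρ ∂μ) := by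
      rw [← mul_assoc, ← mul_assoc, ← ENNReal.ofReal_mul (by positivity), mul_assoc (4 * M),
        ← Real.exp_add, add_neg_cancel, Real.exp_zero, ← ENNReal.ofReal_ofNat 2,
        ← ENNReal.ofReal_mul zero_le_two]
      ring_nf
    _ ≤ _ := by gcongr

/-- A submultiplicative even weight `h ≥ 1` is integrable against the weak limit of
`μ n ∗ compoundPoisson ρ` iff it is integrable against `ρ`, provided that its integrals
against the `μ n` are bounded. -/
lemma lintegral_lt_top_iff_of_tendsto_conv_compoundPoisson {h : E → ℝ} (hc : Continuous h)
    (h1 : ∀ x, 1 ≤ h x) (hz : h 0 ≤ 1) (hneg : ∀ x, h (-x) = h x)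
    (hsub : ∀ x y, h (x + y) ≤ h x * h y)
    (μ : ℕ → Measure E) [∀ n, IsProbabilityMeasure (μ n)] (ρ : Measure E) [IsFiniteMeasure ρ]
    (μ₀ : ProbabilityMeasure E)
    (hlim : Tendsto (β := ProbabilityMeasure E)
      (fun n ↦ ⟨μ n ∗ compoundPoisson ρ, inferInstance⟩) atTop (𝓝 μ₀))
    {M : ℝ} (hM : 0 < M) (hμ : ∀ n, ∫⁻ x, .ofReal (h x) ∂(μ n) ≤ ENNReal.ofReal M) :
    ∫⁻ x, .ofReal (h x) ∂(μ₀ : Measure E) < ⊤ ↔ ∫⁻ x, .ofReal (h x) ∂ρ < ⊤ := by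
  have h0 (x : E) : 0 ≤ h x := zero_le_one.trans (h1 x)
  constructor
  · intro hfin
    set C := ENNReal.ofReal (4 * M * Real.exp (ρ.real Set.univ))
    have htrunc (K : ℕ) : ∫⁻ y, .ofReal (min (h y) K) ∂ρ ≤
        C * ∫⁻ z, .ofReal (h z) ∂(μ₀ : Measure E) := by
      have hn (n : ℕ) : ∫⁻ y, .ofReal (min (h y) K) ∂ρ ≤
          C * ∫⁻ z, .ofReal (min (h z) K) ∂(μ n ∗ compoundPoisson ρ) := by
        refine lintegral_le_mul_lintegral_conv_compoundPoisson hc.measurable h0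
          (by fun_prop) (fun x y ↦ ?_) (μ n) ρ ?_ hM (hμ n)
        · rw [mul_min_of_nonneg _ _ (h0 x)]
          refine min_le_min ?_ (le_mul_of_one_le_left K.cast_nonneg (h1 x))
          simpa [hneg] using hsub (-x) (x + y)
        · refine ((lintegral_mono fun y ↦ ENNReal.ofReal_le_ofReal
            (min_le_right (h y) (K : ℝ))).trans_lt ?_).ne
          simp [ENNReal.mul_lt_top_iff]
      have hlim' := (ProbabilityMeasure.tendsto_iff_forall_lintegral_tendsto.1 hlim)
        (BoundedContinuousFunction.mkOfBound ⟨fun x ↦ (min (h x) K).toNNReal, by fun_prop⟩ K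
          fun x y ↦ by
            rw [NNReal.dist_eq, ContinuousMap.coe_mk,
              Real.coe_toNNReal _ (le_min (h0 x) K.cast_nonneg),
              Real.coe_toNNReal _ (le_min (h0 y) K.cast_nonneg), abs_le]
            have := le_min (h0 x) K.cast_nonneg
            have := le_min (h0 y) K.cast_nonneg
            have := min_le_right (h x) (K : ℝ)
            have := min_le_right (h y) (K : ℝ)
            constructor <;> linarith)
      have hle := ge_of_tendsto' (ENNReal.Tendsto.const_mul hlim' (.inr ENNReal.ofReal_ne_top)) hn
      exact hle.trans (by gcongr; exact ENNReal.ofReal_le_ofReal (min_le_left _ _))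
    refine lt_of_le_of_lt ?_ (ENNReal.mul_lt_top ENNReal.ofReal_lt_top hfin : C * _ < ⊤)
    have hsup (x : E) : ENNReal.ofReal (h x) = ⨆ K : ℕ, ENNReal.ofReal (min (h x) K) := by
      refine le_antisymm ?_ (iSup_le fun K ↦ ENNReal.ofReal_le_ofReal (min_le_left _ _))
      obtain ⟨K, hK⟩ := exists_nat_ge (h x)
      exact le_iSup_of_le K (by rw [min_eq_left hK])
    rw [lintegral_congr hsup, lintegral_iSup (f := fun (K : ℕ) x ↦ ENNReal.ofReal (min (h x) K))
      (fun K ↦ by fun_prop)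
      fun K L hKL x ↦ ENNReal.ofReal_le_ofReal (min_le_min_left _ (by exact_mod_cast hKL))]
    exact iSup_le htrunc
  · intro hfin
    have hint : Integrable h ρ :=
      ⟨by fun_prop, by rwa [hasFiniteIntegral_iff_ofReal (.of_forall h0)]⟩
    set D := ENNReal.ofReal M * ENNReal.ofReal (Real.exp (∫ x, h x ∂ρ - ρ.real Set.univ))
    have hn (n : ℕ) : ∫⁻ x, .ofReal (h x) ∂(μ n ∗ compoundPoisson ρ) ≤ D :=
      (lintegral_conv_le_mul hc.measurable h0 hsub _ _).trans (mul_le_mul' (hμ n)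
        (lintegral_compoundPoisson_le hc.measurable h0 hsub hz ρ hint))
    refine lt_of_le_of_lt (lintegral_le_liminf_lintegral_of_forall_isOpen_measure_le_liminf_measure
      hc h0 fun G hG ↦ ProbabilityMeasure.le_liminf_measure_open_of_tendsto hlim hG) ?_
    refine lt_of_le_of_lt ?_ (ENNReal.mul_lt_top ENNReal.ofReal_lt_top ENNReal.ofReal_lt_top :
      D < ⊤)
    exact (liminf_le_liminf (.of_forall hn)).trans (liminf_const D).le

end WeakLimit

section MomentWeight

variable {ι : Type*} [Fintype ι]

/-- The weight `∏ r, (1 + |x r|) ^ β r`, which controls all mixed moments of order at most `β`. -/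
noncomputable def momentWeight (β : ι → ℝ) (x : EuclideanSpace ℝ ι) : ℝ :=
  ∏ r, (1 + |x r|) ^ β r

variable {β : ι → ℝ}

lemma continuous_momentWeight : Continuous (momentWeight β) := by
  unfold momentWeight
  refine continuous_finsetProd _ fun r _ ↦ ?_
  exact (by fun_prop : Continuous fun x : EuclideanSpace ℝ ι ↦ 1 + |x r|).rpow_const
    fun x ↦ .inl (by positivity)

lemma one_le_momentWeight (hβ : ∀ r, 0 ≤ β r) (x : EuclideanSpace ℝ ι) :
    1 ≤ momentWeight β x := by
  simpa [momentWeight] using Finset.prod_le_prod (s := Finset.univ) (fun _ _ ↦ zero_le_one)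
    fun r _ ↦ Real.one_le_rpow (x := 1 + |x r|) (by simp) (hβ r)

lemma momentWeight_zero : momentWeight β 0 = 1 := by simp [momentWeight]

lemma momentWeight_neg (x : EuclideanSpace ℝ ι) : momentWeight β (-x) = momentWeight β x := by
  simp [momentWeight]

lemma momentWeight_add_le (hβ : ∀ r, 0 ≤ β r) (x y : EuclideanSpace ℝ ι) :
    momentWeight β (x + y) ≤ momentWeight β x * momentWeight β y := by
  unfold momentWeight
  rw [← Finset.prod_mul_distrib]
  refine Finset.prod_le_prod (fun r _ ↦ by positivity) fun r _ ↦ ?_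
  rw [← Real.mul_rpow (by positivity) (by positivity)]
  refine Real.rpow_le_rpow (by positivity) ?_ (hβ r)
  rw [PiLp.add_apply]
  nlinarith [abs_add_le (x r) (y r), abs_nonneg (x r), abs_nonneg (y r),
    mul_nonneg (abs_nonneg (x r)) (abs_nonneg (y r))]

lemma momentWeight_le_sum_exp [Nonempty ι] (hβ : ∀ r, 0 ≤ β r) (x : EuclideanSpace ℝ ι) :
    momentWeight β x ≤
      ∑ i, (Real.exp ((∑ r, β r) * x i) + Real.exp (-(∑ r, β r) * x i)) := by
  obtain ⟨i, hi⟩ := Finite.exists_max fun r ↦ |x r|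
  have hB : 0 ≤ ∑ r, β r := Finset.sum_nonneg fun r _ ↦ hβ r
  calc momentWeight β x ≤ ∏ r, Real.exp (|x i| * β r) := by
        refine Finset.prod_le_prod (fun r _ ↦ by positivity) fun r _ ↦ ?_
        rw [Real.exp_mul]
        refine Real.rpow_le_rpow (by positivity) ?_ (hβ r)
        linarith [hi r, Real.add_one_le_exp |x i|]
    _ = Real.exp ((∑ r, β r) * |x i|) := by
        rw [← Real.exp_sum, ← Finset.mul_sum, mul_comm]
    _ ≤ Real.exp ((∑ r, β r) * x i) + Real.exp (-(∑ r, β r) * x i) := by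
        rw [neg_mul, ← abs_of_nonneg hB, ← abs_mul, abs_of_nonneg hB]
        exact Real.exp_abs_le _
    _ ≤ _ := Finset.single_le_sum
        (f := fun i ↦ Real.exp ((∑ r, β r) * x i) + Real.exp (-(∑ r, β r) * x i))
        (fun j _ ↦ by positivity) (Finset.mem_univ i)

lemma one_add_rpow_le {u b : ℝ} (hu : 0 ≤ u) (hb : 0 ≤ b) :
    (1 + u) ^ b ≤ 2 ^ b * (1 + u ^ b) := by
  rcases le_total u 1 with h | h
  · calc (1 + u) ^ b ≤ 2 ^ b := Real.rpow_le_rpow (by positivity) (by linarith) hb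
      _ ≤ _ := le_mul_of_one_le_right (by positivity) (by linarith [Real.rpow_nonneg hu b])
  · calc (1 + u) ^ b ≤ (2 * u) ^ b := Real.rpow_le_rpow (by positivity) (by linarith) hb
      _ = 2 ^ b * u ^ b := Real.mul_rpow zero_le_two hu
      _ ≤ _ := by gcongr; linarith

lemma prod_rpow_le_momentWeight {α : ι → ℝ} (hα : ∀ r, α r ∈ Set.Icc 0 (β r))
    (x : EuclideanSpace ℝ ι) : ∏ r, |x r| ^ α r ≤ momentWeight β x := by
  refine Finset.prod_le_prod (fun r _ ↦ by positivity) fun r _ ↦ ?_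
  calc |x r| ^ α r ≤ (1 + |x r|) ^ α r :=
        Real.rpow_le_rpow (by positivity) (by linarith) (hα r).1
    _ ≤ _ := Real.rpow_le_rpow_of_exponent_le (by simp) (hα r).2

open Classical in
lemma momentWeight_le_sum_prod_rpow (hβ : ∀ r, 0 ≤ β r) (x : EuclideanSpace ℝ ι) :
    momentWeight β x ≤ (∏ r, 2 ^ β r) *
      ∑ S : Finset ι, ∏ r, |x r| ^ (if r ∈ S then β r else 0) := by
  calc momentWeight β x ≤ ∏ r, 2 ^ β r * (1 + |x r| ^ β r) :=
        Finset.prod_le_prod (fun r _ ↦ by positivity)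
          fun r _ ↦ one_add_rpow_le (abs_nonneg _) (hβ r)
    _ = _ := by
        rw [Finset.prod_mul_distrib, Finset.prod_one_add, Finset.powerset_univ]
        congr 1
        refine Finset.sum_congr rfl fun S _ ↦ ?_
        simp_rw [apply_ite (fun e : ℝ ↦ |x _| ^ e), Real.rpow_zero]
        simp [Finset.prod_ite_mem]

/-- Finiteness of all mixed moments of order at most `β` is integrability of `momentWeight β`. -/
lemma forall_lintegral_prod_rpow_lt_top_iff (hβ : ∀ r, 0 ≤ β r)
    (m : Measure (EuclideanSpace ℝ ι)) :
    (∀ α : ι → ℝ, (∀ r, α r ∈ Set.Icc 0 (β r)) →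
        ∫⁻ x, ENNReal.ofReal (∏ r, |x r| ^ α r) ∂m < ⊤) ↔
      ∫⁻ x, ENNReal.ofReal (momentWeight β x) ∂m < ⊤ := by
  classical
  refine ⟨fun h ↦ ?_, fun h α hα ↦ (lintegral_mono fun x ↦
    ENNReal.ofReal_le_ofReal (prod_rpow_le_momentWeight hα x)).trans_lt h⟩
  refine (lintegral_mono fun x ↦
    ENNReal.ofReal_le_ofReal (momentWeight_le_sum_prod_rpow hβ x)).trans_lt ?_
  simp_rw [ENNReal.ofReal_mul (Finset.prod_nonneg fun r _ ↦ Real.rpow_nonneg zero_le_two (β r)),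
    ENNReal.ofReal_sum_of_nonneg fun S _ ↦ Finset.prod_nonneg fun r _ ↦
      Real.rpow_nonneg (abs_nonneg _) _]
  rw [lintegral_const_mul _ (by fun_prop), lintegral_finsetSum _ (by fun_prop)]
  refine ENNReal.mul_lt_top ENNReal.ofReal_lt_top (ENNReal.sum_lt_top.2 fun S _ ↦ h _ fun r ↦ ?_)
  split_ifs
  exacts [⟨hβ r, le_rfl⟩, ⟨le_rfl, hβ r⟩]

end MomentWeight

section LevyKhintchine

open Filter Topology

lemma integrable_normSq_div_of_lintegral_lt_top {E : Type*} [NormedAddCommGroup E]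
    [MeasurableSpace E] [BorelSpace E] {ν : Measure E}
    (hν : ∫⁻ x, ENNReal.ofReal (‖x‖ ^ 2 / (1 + ‖x‖ ^ 2)) ∂ν < ⊤) :
    Integrable (fun x ↦ ‖x‖ ^ 2 / (1 + ‖x‖ ^ 2)) ν :=
  ⟨Measurable.aestronglyMeasurable (by fun_prop), by
    rwa [hasFiniteIntegral_iff_ofReal (.of_forall fun x ↦ by positivity)]⟩

lemma measure_le_norm_lt_top {E : Type*} [NormedAddCommGroup E] [MeasurableSpace E]
    {ν : Measure E}
    (hν : Integrable (fun x ↦ ‖x‖ ^ 2 / (1 + ‖x‖ ^ 2)) ν) {ε : ℝ} (hε : 0 < ε) :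
    ν {x | ε ≤ ‖x‖} < ⊤ := by
  refine (measure_mono fun x hx ↦ ?_).trans_lt
    (hν.measure_ge_lt_top (ε := ε ^ 2 / (1 + ε ^ 2)) (by positivity))
  have hx : ε ≤ ‖x‖ := hx
  have : ε ^ 2 ≤ ‖x‖ ^ 2 := by gcongr
  rw [Set.mem_ofPred_eq, div_le_div_iff₀ (by positivity) (by positivity)]
  nlinarith

section Kernel

variable {E : Type*} [NormedAddCommGroup E] [InnerProductSpace ℝ E]

lemma norm_exp_sub_one_sub_div_le {z : ℂ} {K R r : ℝ} (hK : 0 ≤ K) (hr0 : 0 ≤ r) (hr : r ≤ R)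
    (hz : ‖z‖ ≤ K * r) :
    ‖Complex.exp z - 1 - z / ((1 + r ^ 2 : ℝ) : ℂ)‖ ≤
      (K ^ 2 * Real.exp (K * R) * (1 + R ^ 2) + K * R) * (r ^ 2 / (1 + r ^ 2)) := by
  have hpos : 0 < 1 + r ^ 2 := by positivity
  have hne : ((1 + r ^ 2 : ℝ) : ℂ) ≠ 0 := Complex.ofReal_ne_zero.2 hpos.ne'
  have hsplit : Complex.exp z - 1 - z / ((1 + r ^ 2 : ℝ) : ℂ) =
      (Complex.exp z - 1 - z) + z * ((r ^ 2 / (1 + r ^ 2) : ℝ) : ℂ) := by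
    push_cast at hne ⊢
    field_simp
    ring
  have hexp : ‖Complex.exp z - 1 - z‖ ≤ ‖z‖ ^ 2 * Real.exp ‖z‖ := by
    simpa [Finset.sum_range_succ, sub_sub] using Complex.norm_exp_sub_sum_le_norm_mul_exp z 2
  have hzR : ‖z‖ ≤ K * R := hz.trans (by gcongr)
  rw [hsplit, add_mul]
  refine (norm_add_le _ _).trans (add_le_add ?_ ?_)
  · calc _ ≤ (K * r) ^ 2 * Real.exp (K * R) := hexp.trans (by gcongr)
      _ = K ^ 2 * Real.exp (K * R) * (1 + r ^ 2) * (r ^ 2 / (1 + r ^ 2)) := by field_simp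
      _ ≤ _ := by gcongr
  · rw [norm_mul, Complex.norm_real, Real.norm_of_nonneg (by positivity)]
    gcongr

lemma norm_levyKhintchine_kernel_le (t x : E) :
    ‖Complex.exp (Complex.I * ((⟪t, x⟫ : ℝ) : ℂ)) - 1
        - Complex.I * ((⟪t, x⟫ : ℝ) : ℂ) / ((1 + ‖x‖ ^ 2 : ℝ) : ℂ)‖ ≤
      (‖t‖ ^ 2 * Real.exp ‖t‖ * 2 + ‖t‖ + 2 * (2 + ‖t‖)) * (‖x‖ ^ 2 / (1 + ‖x‖ ^ 2)) := by
  have hz : ‖Complex.I * ((⟪t, x⟫ : ℝ) : ℂ)‖ ≤ ‖t‖ * ‖x‖ := by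
    simpa using abs_real_inner_le_norm t x
  have hpos : 0 < 1 + ‖x‖ ^ 2 := by positivity
  rw [add_mul]
  rcases le_total ‖x‖ 1 with hx | hx
  · refine (norm_exp_sub_one_sub_div_le (norm_nonneg t) (norm_nonneg x) hx hz).trans ?_
    rw [mul_one, one_pow, one_add_one_eq_two]
    exact le_add_of_nonneg_right (by positivity)
  · refine le_add_of_nonneg_of_le (by positivity) ?_
    have hquot : ‖Complex.I * ((⟪t, x⟫ : ℝ) : ℂ) / ((1 + ‖x‖ ^ 2 : ℝ) : ℂ)‖ ≤ ‖t‖ := by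
      rw [norm_div, Complex.norm_real, Real.norm_of_nonneg hpos.le, div_le_iff₀ hpos]
      exact hz.trans (by gcongr; nlinarith)
    have hhalf : 1 ≤ 2 * (‖x‖ ^ 2 / (1 + ‖x‖ ^ 2)) := by
      rw [← mul_div_assoc, le_div_iff₀ hpos]
      nlinarith
    have hexp : ‖Complex.exp (Complex.I * ((⟪t, x⟫ : ℝ) : ℂ))‖ = 1 := by
      rw [mul_comm, Complex.norm_exp_ofReal_mul_I]
    calc _ ≤ 1 + 1 + ‖t‖ := by
          refine (norm_sub_le _ _).trans (add_le_add ((norm_sub_le _ _).trans ?_) hquot)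
          rw [hexp, norm_one]
      _ ≤ (2 + ‖t‖) * (2 * (‖x‖ ^ 2 / (1 + ‖x‖ ^ 2))) := by
          nlinarith [norm_nonneg t]
      _ = _ := by ring

variable [MeasurableSpace E] [BorelSpace E] [SecondCountableTopology E]

lemma integrable_levyKhintchine_kernel {ν : Measure E}
    (hν : Integrable (fun x ↦ ‖x‖ ^ 2 / (1 + ‖x‖ ^ 2)) ν) (t : E) :
    Integrable (fun x ↦ Complex.exp (Complex.I * ((⟪t, x⟫ : ℝ) : ℂ)) - 1
        - Complex.I * ((⟪t, x⟫ : ℝ) : ℂ) / ((1 + ‖x‖ ^ 2 : ℝ) : ℂ)) ν :=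
  (hν.const_mul _).mono' (by fun_prop) (.of_forall (norm_levyKhintchine_kernel_le t))

lemma integrable_inv_one_add_normSq_smul (ρ : Measure E) [IsFiniteMeasure ρ] :
    Integrable (fun x ↦ (1 + ‖x‖ ^ 2)⁻¹ • x) ρ := by
  refine (integrable_const (1 : ℝ)).mono' (by fun_prop) (.of_forall fun x ↦ ?_)
  rw [norm_smul, Real.norm_of_nonneg (by positivity), inv_mul_le_iff₀ (by positivity)]
  nlinarith [sq_nonneg (‖x‖ - 1)]

lemma integral_levyKhintchine_kernel [CompleteSpace E] (ρ : Measure E) [IsFiniteMeasure ρ]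
    (t : E) :
    ∫ x, (Complex.exp (Complex.I * ((⟪t, x⟫ : ℝ) : ℂ)) - 1
        - Complex.I * ((⟪t, x⟫ : ℝ) : ℂ) / ((1 + ‖x‖ ^ 2 : ℝ) : ℂ)) ∂ρ =
      charFun ρ t - ρ.real Set.univ -
        Complex.I * ((⟪t, ∫ x, (1 + ‖x‖ ^ 2)⁻¹ • x ∂ρ⟫ : ℝ) : ℂ) := by
  have hm := integrable_inv_one_add_normSq_smul ρ
  have hexp : Integrable (fun x ↦ Complex.exp (Complex.I * ((⟪t, x⟫ : ℝ) : ℂ)) - 1) ρ := by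
    refine Integrable.sub ?_ (integrable_const _)
    exact (integrable_const (1 : ℝ)).mono' (by fun_prop)
      (.of_forall fun x ↦ by rw [mul_comm, Complex.norm_exp_ofReal_mul_I])
  rw [charFun_sub_measureReal_univ, ← integral_inner hm t, ← integral_complex_ofReal,
    ← integral_const_mul, ← integral_sub]
  · refine integral_congr_ae (.of_forall fun x ↦ ?_)
    simp only [real_inner_smul_right, real_inner_comm t x]
    push_cast
    ring_nf
  · simpa only [real_inner_comm t, mul_comm Complex.I] using hexp
  · exact ((hm.const_inner t).ofReal).const_mul _

end Kernel

section Approximation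

variable {ι : Type*} [Fintype ι] [DecidableEq ι]

/-- The infinitely divisible distribution with Gaussian covariance `A` and finite Lévy measure `ρ`,
centred so that `∫ (1 + ‖x‖ ^ 2)⁻¹ • x` with respect to `ρ + σ` is compensated. -/
noncomputable def compensatedGaussianPoisson (a : EuclideanSpace ℝ ι) (A : Matrix ι ι ℝ)
    (ρ σ : Measure (EuclideanSpace ℝ ι)) : Measure (EuclideanSpace ℝ ι) :=
  multivariateGaussian
    (a - ∫ x, (1 + ‖x‖ ^ 2)⁻¹ • x ∂ρ - ∫ x, (1 + ‖x‖ ^ 2)⁻¹ • x ∂σ) A ∗ compoundPoisson ρ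

variable (a : EuclideanSpace ℝ ι) {A : Matrix ι ι ℝ} (ρ σ : Measure (EuclideanSpace ℝ ι))
  [IsFiniteMeasure ρ]

instance isProbabilityMeasure_compensatedGaussianPoisson :
    IsProbabilityMeasure (compensatedGaussianPoisson a A ρ σ) := by
  unfold compensatedGaussianPoisson
  infer_instance

lemma charFun_compensatedGaussianPoisson_conv [IsFiniteMeasure σ] (hA : A.PosSemidef)
    (t : EuclideanSpace ℝ ι) :
    charFun (compensatedGaussianPoisson a A ρ σ ∗ compoundPoisson σ) t =
      Complex.exp (Complex.I * ((⟪a, t⟫ : ℝ) : ℂ)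
        - ((∑ i, ∑ j, A i j * t i * t j : ℝ) : ℂ) / 2
        + ((∫ x, (Complex.exp (Complex.I * ((⟪t, x⟫ : ℝ) : ℂ)) - 1
              - Complex.I * ((⟪t, x⟫ : ℝ) : ℂ) / ((1 + ‖x‖ ^ 2 : ℝ) : ℂ)) ∂ρ)
          + ∫ x, (Complex.exp (Complex.I * ((⟪t, x⟫ : ℝ) : ℂ)) - 1
              - Complex.I * ((⟪t, x⟫ : ℝ) : ℂ) / ((1 + ‖x‖ ^ 2 : ℝ) : ℂ)) ∂σ)) := by
  have hQ : ∑ i, ∑ j, A i j * t i * t j = t.ofLp ⬝ᵥ A.mulVec t.ofLp := by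
    simp only [dotProduct, Matrix.mulVec, Finset.mul_sum]
    refine Finset.sum_congr rfl fun i _ ↦ Finset.sum_congr rfl fun j _ ↦ by ring
  rw [compensatedGaussianPoisson, charFun_conv, charFun_conv, charFun_multivariateGaussian hA,
    charFun_compoundPoisson, charFun_compoundPoisson, ← Complex.exp_add, ← Complex.exp_add,
    integral_levyKhintchine_kernel, integral_levyKhintchine_kernel, hQ, inner_sub_right,
    inner_sub_right, real_inner_comm a t]
  push_cast
  ring_nf

lemma lintegral_exp_multivariateGaussian (hA : A.PosSemidef) (s : ℝ) (i : ι) :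
    ∫⁻ x, .ofReal (Real.exp (s * x i)) ∂(multivariateGaussian a A) =
      ENNReal.ofReal (Real.exp (s * a i + A i i * s ^ 2 / 2)) := by
  have hmp := measurePreserving_eval_multivariateGaussian (μ := a) hA (i := i)
  have hAi : 0 ≤ A i i := hA.diag_nonneg
  rw [hmp.lintegral_comp (f := fun u ↦ ENNReal.ofReal (Real.exp (s * u))) (by fun_prop),
    ← ofReal_integral_eq_lintegral_ofReal (integrable_exp_mul_gaussianReal s)
      (.of_forall fun x ↦ (Real.exp_pos _).le)]
  have h := congrFun (mgf_fun_id_gaussianReal (μ := a i) (v := (A i i).toNNReal)) s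
  rw [mgf] at h
  rw [h, Real.coe_toNNReal _ hAi, mul_comm (a i)]

lemma lintegral_exp_compensatedGaussianPoisson_le (hA : A.PosSemidef) {τ : ℝ}
    (hρτ : ∀ᵐ x ∂ρ, ‖x‖ ≤ τ) (s : ℝ) (i : ι) :
    ∫⁻ x, .ofReal (Real.exp (s * x i)) ∂(compensatedGaussianPoisson a A ρ σ) ≤
      ENNReal.ofReal (Real.exp (s * (a i - (∫ x, (1 + ‖x‖ ^ 2)⁻¹ • x ∂σ) i) + A i i * s ^ 2 / 2 +
        (s ^ 2 * Real.exp (|s| * τ) * (1 + τ ^ 2) + |s| * τ) *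
          ∫ x, ‖x‖ ^ 2 / (1 + ‖x‖ ^ 2) ∂ρ)) := by
  have hcoord (x : EuclideanSpace ℝ ι) : |s * x i| ≤ |s| * ‖x‖ := by
    rw [abs_mul]
    gcongr
    exact PiLp.norm_apply_le x i
  have hexp : Integrable (fun x : EuclideanSpace ℝ ι ↦ Real.exp (s * x i)) ρ := by
    refine (integrable_const (Real.exp (|s| * τ))).mono' (by fun_prop) ?_
    filter_upwards [hρτ] with x hx
    rw [Real.norm_of_nonneg (Real.exp_pos _).le, Real.exp_le_exp]
    exact (le_abs_self _).trans ((hcoord x).trans (by gcongr))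
  have hexp1 : Integrable (fun x : EuclideanSpace ℝ ι ↦ Real.exp (s * x i) - 1) ρ :=
    hexp.sub (integrable_const _)
  have hm := integrable_inv_one_add_normSq_smul ρ
  have hmi : Integrable (fun x ↦ s * ((1 + ‖x‖ ^ 2)⁻¹ * x i)) ρ := by
    simpa using ((EuclideanSpace.proj (𝕜 := ℝ) i).integrable_comp hm).const_mul s
  have hmean : (∫ x, (1 + ‖x‖ ^ 2)⁻¹ • x ∂ρ) i = ∫ x, (1 + ‖x‖ ^ 2)⁻¹ * x i ∂ρ := by
    simpa using ((EuclideanSpace.proj (𝕜 := ℝ) i).integral_comp_comm hm).symm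
  have hsq : Integrable (fun x : EuclideanSpace ℝ ι ↦ ‖x‖ ^ 2 / (1 + ‖x‖ ^ 2)) ρ := by
    refine (integrable_const (1 : ℝ)).mono' (Measurable.aestronglyMeasurable (by fun_prop))
      (.of_forall fun x ↦ ?_)
    rw [Real.norm_of_nonneg (by positivity), div_le_one (by positivity)]
    linarith
  have hkernel : ∫ x, (Real.exp (s * x i) - 1 - s * ((1 + ‖x‖ ^ 2)⁻¹ * x i)) ∂ρ ≤
      (s ^ 2 * Real.exp (|s| * τ) * (1 + τ ^ 2) + |s| * τ) *
        ∫ x, ‖x‖ ^ 2 / (1 + ‖x‖ ^ 2) ∂ρ := by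
    rw [← integral_const_mul]
    refine integral_mono_ae (hexp1.sub hmi) (hsq.const_mul _) ?_
    filter_upwards [hρτ] with x hx
    have h := norm_exp_sub_one_sub_div_le (z := ((s * x i : ℝ) : ℂ)) (abs_nonneg s) (norm_nonneg x)
      hx (by rw [Complex.norm_real]; exact hcoord x)
    rw [sq_abs] at h
    refine le_trans ?_ h
    rw [← Complex.ofReal_exp, ← Complex.ofReal_one, ← Complex.ofReal_sub, ← Complex.ofReal_div,
      ← Complex.ofReal_sub, Complex.norm_real]
    refine le_trans (le_of_eq ?_) (le_abs_self _)
    ring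
  rw [integral_sub hexp1 hmi, integral_sub hexp (integrable_const _),
    integral_const_mul, integral_const, smul_eq_mul, mul_one, ← hmean] at hkernel
  have hadd (x y : EuclideanSpace ℝ ι) :
      Real.exp (s * (x + y) i) ≤ Real.exp (s * x i) * Real.exp (s * y i) := by
    rw [PiLp.add_apply, mul_add, Real.exp_add]
  refine (lintegral_conv_le_mul (h := fun x : EuclideanSpace ℝ ι ↦ Real.exp (s * x i))
    (by fun_prop) (fun x ↦ (Real.exp_pos _).le) hadd _ _).trans ?_
  rw [lintegral_exp_multivariateGaussian _ hA]
  refine (mul_le_mul_right (lintegral_compoundPoisson_le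
    (h := fun x : EuclideanSpace ℝ ι ↦ Real.exp (s * x i))
    (by fun_prop) (fun x ↦ (Real.exp_pos _).le) hadd (by simp) ρ hexp) _).trans ?_
  rw [← ENNReal.ofReal_mul (Real.exp_pos _).le, ← Real.exp_add]
  refine ENNReal.ofReal_le_ofReal (Real.exp_le_exp.2 ?_)
  simp only [PiLp.sub_apply]
  linarith

end Approximation

/-- The part of `ν` carried by the annulus `(n + 1)⁻¹ ≤ ‖x‖ < τ`. -/
noncomputable def annulusRestrict {E : Type*} [NormedAddCommGroup E] [MeasurableSpace E]
    (ν : Measure E) (τ : ℝ) (n : ℕ) : Measure E :=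
  ν.restrict ({x | ((n : ℝ) + 1)⁻¹ ≤ ‖x‖} \ {x | τ ≤ ‖x‖})

/-- The integral of a `ν`-integrable function is the limit of its integrals over the complements
of shrinking balls around the origin. -/
lemma tendsto_integral_annulusRestrict {E F : Type*} [NormedAddCommGroup E] [MeasurableSpace E]
    [BorelSpace E] [NormedAddCommGroup F] [NormedSpace ℝ F] {ν : Measure E} (hν0 : ν {0} = 0)
    {f : E → F} (hf : Integrable f ν) (τ : ℝ) :
    Tendsto (fun n ↦ ∫ x, f x ∂(annulusRestrict ν τ n) + ∫ x in {x | τ ≤ ‖x‖}, f x ∂ν) atTop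
      (𝓝 (∫ x, f x ∂ν)) := by
  have hT : MeasurableSet {x : E | τ ≤ ‖x‖} := measurableSet_le measurable_const measurable_norm
  have hS (n : ℕ) : MeasurableSet ({x : E | ((n : ℝ) + 1)⁻¹ ≤ ‖x‖} \ {x | τ ≤ ‖x‖}) :=
    (measurableSet_le measurable_const measurable_norm).diff hT
  have hmono : Monotone fun n : ℕ ↦
      ({x : E | ((n : ℝ) + 1)⁻¹ ≤ ‖x‖} \ {x | τ ≤ ‖x‖}) ∪ {x | τ ≤ ‖x‖} := by
    intro m n hmn
    refine Set.union_subset_union_left _ (Set.sdiff_subset_sdiff_left fun x hx ↦ ?_)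
    exact le_trans (by gcongr) (show ((m : ℝ) + 1)⁻¹ ≤ ‖x‖ from hx)
  have hunion : ν.restrict (⋃ n : ℕ,
      ({x : E | ((n : ℝ) + 1)⁻¹ ≤ ‖x‖} \ {x | τ ≤ ‖x‖}) ∪ {x | τ ≤ ‖x‖}) = ν := by
    refine Measure.restrict_eq_self_of_ae_mem ?_
    filter_upwards [measure_eq_zero_iff_ae_notMem.1 hν0] with x hx
    obtain ⟨n, hn⟩ := exists_nat_one_div_lt (norm_pos_iff.2 hx)
    refine Set.mem_iUnion.2 ⟨n, ?_⟩
    rw [Set.sdiff_union_self]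
    exact .inl (by simpa using hn.le)
  have h := tendsto_setIntegral_of_monotone (μ := ν) (f := f) (fun n ↦ (hS n).union hT) hmono
    hf.integrableOn
  rw [hunion] at h
  refine h.congr fun n ↦ ?_
  rw [setIntegral_union Set.disjoint_sdiff_left hT hf.integrableOn hf.integrableOn]
  rfl

/-- The compensated approximations of an infinitely divisible distribution with jumps bounded by
`τ` have uniformly bounded moments. -/
lemma exists_forall_lintegral_momentWeight_le {ι : Type*} [Fintype ι] [DecidableEq ι] [Nonempty ι]
    {β : ι → ℝ} (hβ : ∀ r, 0 ≤ β r) (a : EuclideanSpace ℝ ι) {A : Matrix ι ι ℝ}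
    (hA : A.PosSemidef) {ν σ : Measure (EuclideanSpace ℝ ι)}
    (hν : Integrable (fun x ↦ ‖x‖ ^ 2 / (1 + ‖x‖ ^ 2)) ν) {τ : ℝ} (hτ : 0 < τ) :
    ∃ M : ℝ, 0 < M ∧ ∀ ρ : Measure (EuclideanSpace ℝ ι), IsFiniteMeasure ρ → ρ ≤ ν →
      (∀ᵐ x ∂ρ, ‖x‖ ≤ τ) →
      ∫⁻ x, .ofReal (momentWeight β x) ∂(compensatedGaussianPoisson a A ρ σ) ≤
        ENNReal.ofReal M := by
  set c : ℝ → ι → ℝ := fun s i ↦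
    Real.exp (s * (a i - (∫ x, (1 + ‖x‖ ^ 2)⁻¹ • x ∂σ) i) + A i i * s ^ 2 / 2 +
      (s ^ 2 * Real.exp (|s| * τ) * (1 + τ ^ 2) + |s| * τ) * ∫ x, ‖x‖ ^ 2 / (1 + ‖x‖ ^ 2) ∂ν)
  have hcpos (s : ℝ) (i : ι) : 0 < c s i := Real.exp_pos _
  refine ⟨∑ i, (c (∑ r, β r) i + c (-∑ r, β r) i),
    Finset.sum_pos (fun i _ ↦ add_pos (hcpos _ i) (hcpos _ i)) Finset.univ_nonempty,
    fun ρ _ hρν hρτ ↦ ?_⟩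
  have hexp (s : ℝ) (i : ι) : ∫⁻ x, .ofReal (Real.exp (s * x i))
      ∂(compensatedGaussianPoisson a A ρ σ) ≤ ENNReal.ofReal (c s i) := by
    refine (lintegral_exp_compensatedGaussianPoisson_le a ρ σ hA hρτ s i).trans
      (ENNReal.ofReal_le_ofReal (Real.exp_le_exp.2 ?_))
    gcongr
    exact .of_forall fun x ↦ by positivity
  refine (lintegral_mono fun x ↦
    ENNReal.ofReal_le_ofReal (momentWeight_le_sum_exp hβ x)).trans ?_
  simp_rw [ENNReal.ofReal_sum_of_nonneg fun (i : ι) _ ↦ (add_pos (hcpos _ i) (hcpos _ i)).le,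
    ENNReal.ofReal_sum_of_nonneg fun (i : ι) _ ↦
      (add_pos (Real.exp_pos (_ * _)) (Real.exp_pos (_ * _))).le,
    ENNReal.ofReal_add (hcpos _ _).le (hcpos _ _).le,
    ENNReal.ofReal_add (Real.exp_pos _).le (Real.exp_pos _).le]
  rw [lintegral_finsetSum _ (by fun_prop)]
  refine Finset.sum_le_sum fun i _ ↦ ?_
  rw [lintegral_add_left (by fun_prop)]
  exact add_le_add (hexp _ i) (hexp _ i)

end LevyKhintchine

/-- **Theorem 1.** Let `X = (X₁,…,X_p)` be an infinitely divisible random vector whose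
characteristic function has the Lévy–Khintchine form with Lévy measure `ν`, and let
`β_r ∈ [0,∞)`.  Then `E(∏ r, |X_r|^{α_r}) < ∞` for all `α_r ∈ [0, β_r]` if and only if
`∫ ∏ r, |x_r|^{α_r} dν₁(x) < ∞` for all `α_r ∈ [0, β_r]`, where `ν₁` is the restriction
of `ν` to `{x : ‖x‖ ≥ τ}`. -/
theorem moments_id_iff_moments_levy_restriction
    {Ω : Type*} [MeasurableSpace Ω] (P : Measure Ω) [IsProbabilityMeasure P]
    (p : ℕ) (hp : 1 ≤ p)
    (X : Ω → EuclideanSpace ℝ (Fin p)) (hX : Measurable X)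
    (a : EuclideanSpace ℝ (Fin p))
    (A : Matrix (Fin p) (Fin p) ℝ) (hA : A.PosSemidef)
    (ν : Measure (EuclideanSpace ℝ (Fin p)))
    (hν0 : ν {0} = 0)
    (hνint : ∫⁻ x, ENNReal.ofReal (‖x‖ ^ 2 / (1 + ‖x‖ ^ 2)) ∂ν < ⊤)
    (hφ : ∀ t : EuclideanSpace ℝ (Fin p),
      ∫ ω, Complex.exp (Complex.I * (⟪t, X ω⟫ : ℝ)) ∂P =
        Complex.exp (Complex.I * ((⟪a, t⟫ : ℝ) : ℂ)
          - ((∑ i, ∑ j, A i j * t i * t j : ℝ) : ℂ) / 2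
          + ∫ x, (Complex.exp (Complex.I * ((⟪t, x⟫ : ℝ) : ℂ)) - 1
              - Complex.I * ((⟪t, x⟫ : ℝ) : ℂ) / ((1 + ‖x‖ ^ 2 : ℝ) : ℂ)) ∂ν))
    (τ : ℝ) (hτ : 0 < τ)
    (β : Fin p → ℝ) (hβ : ∀ r, 0 ≤ β r) :
    (∀ α : Fin p → ℝ, (∀ r, α r ∈ Set.Icc 0 (β r)) →
        ∫⁻ ω, ENNReal.ofReal (∏ r, |X ω r| ^ α r) ∂P < ⊤) ↔
      (∀ α : Fin p → ℝ, (∀ r, α r ∈ Set.Icc 0 (β r)) →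
        ∫⁻ x, ENNReal.ofReal (∏ r, |x r| ^ α r) ∂(ν.restrict {x | τ ≤ ‖x‖}) < ⊤) := by
  classical
  have : Nonempty (Fin p) := ⟨⟨0, hp⟩⟩
  have hν := integrable_normSq_div_of_lintegral_lt_top hνint
  set ρ := annulusRestrict ν τ
  set σ := ν.restrict {x | τ ≤ ‖x‖}
  have hρfin (n : ℕ) : IsFiniteMeasure (ρ n) := by
    refine isFiniteMeasure_restrict.2 (lt_of_le_of_lt (measure_mono Set.sdiff_subset)
      (measure_le_norm_lt_top hν (by positivity))).ne
  have hσfin : IsFiniteMeasure σ := isFiniteMeasure_restrict.2 (measure_le_norm_lt_top hν hτ).ne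
  have hρτ (n : ℕ) : ∀ᵐ x ∂(ρ n), ‖x‖ ≤ τ := by
    refine (ae_restrict_iff' ?_).2 (.of_forall fun x hx ↦ (not_le.1 hx.2).le)
    exact (measurableSet_le measurable_const measurable_norm).diff
      (measurableSet_le measurable_const measurable_norm)
  let μ₀ : ProbabilityMeasure (EuclideanSpace ℝ (Fin p)) :=
    ⟨P.map X, Measure.isProbabilityMeasure_map hX.aemeasurable⟩
  have hchar (t : EuclideanSpace ℝ (Fin p)) : charFun (P.map X) t =
      ∫ ω, Complex.exp (Complex.I * (⟪t, X ω⟫ : ℝ)) ∂P := by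
    rw [charFun_apply, integral_map hX.aemeasurable (by fun_prop)]
    simp only [real_inner_comm t, mul_comm Complex.I]
  have hlim : Filter.Tendsto (β := ProbabilityMeasure (EuclideanSpace ℝ (Fin p)))
      (fun n ↦ ⟨compensatedGaussianPoisson a A (ρ n) σ ∗ compoundPoisson σ, inferInstance⟩)
      Filter.atTop (nhds μ₀) := by
    refine ProbabilityMeasure.tendsto_of_tendsto_charFun fun t ↦ ?_
    simp only [ProbabilityMeasure.coe_mk, μ₀, hchar, hφ,
      charFun_compensatedGaussianPoisson_conv a _ σ hA]
    refine (Complex.continuous_exp.tendsto _).comp (Filter.Tendsto.const_add _ ?_)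
    exact tendsto_integral_annulusRestrict hν0 (integrable_levyKhintchine_kernel hν t) τ
  obtain ⟨M, hM, hbound⟩ :=
    exists_forall_lintegral_momentWeight_le (σ := σ) hβ a hA hν hτ
  have hmap (α : Fin p → ℝ) : ∫⁻ ω, ENNReal.ofReal (∏ r, |X ω r| ^ α r) ∂P =
      ∫⁻ x, ENNReal.ofReal (∏ r, |x r| ^ α r) ∂(P.map X) :=
    (lintegral_map (f := fun x : EuclideanSpace ℝ (Fin p) ↦ ENNReal.ofReal (∏ r, |x r| ^ α r))
      (by fun_prop) hX).symm
  simp only [hmap]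
  rw [forall_lintegral_prod_rpow_lt_top_iff hβ, forall_lintegral_prod_rpow_lt_top_iff hβ]
  exact lintegral_lt_top_iff_of_tendsto_conv_compoundPoisson continuous_momentWeight
    (one_le_momentWeight hβ) momentWeight_zero.le momentWeight_neg (momentWeight_add_le hβ)
    _ σ μ₀ hlim hM
    fun n ↦ hbound (ρ n) (hρfin n) Measure.restrict_le_self (hρτ n)
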